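/- Let π : B → C be a surjective morphism of weak Hopf *-algebras and let I(π) := { b ∈ B : (π ⊗ id)Δ(b) = (π ⊗ id)((1 ⊗ b)Δ(1)) } be the associated quotient type coideal. Then I(π) is invariant under the right adjoint action: S(x₍₁₎) b x₍₂₎ ∈ I(π) for all b ∈ I(π) and x ∈ B; moreover every element of I(π) commutes with every element of B_t. -/

import Mathlib

open scoped TensorProduct
open TensorProduct

noncomputable section

/-- The conjugate-linear "star" operation on a tensor product of two star modules,
defined via a choice of bases so that `star (x ⊗ y) = star x ⊗ star y`. -/
def tensorStar (M N : Type) [AddCommGroup M] [Module ℂ M] [Module.Finite ℂ M]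
    [Module.Free ℂ M] [StarAddMonoid M] [AddCommGroup N] [Module ℂ N] [Module.Finite ℂ N]
    [Module.Free ℂ N] [StarAddMonoid N] (t : M ⊗[ℂ] N) : M ⊗[ℂ] N :=
  let bM := Module.Free.chooseBasis ℂ M
  let bN := Module.Free.chooseBasis ℂ N
  ∑ p : Module.Free.ChooseBasisIndex ℂ M × Module.Free.ChooseBasisIndex ℂ N,
    (starRingEnd ℂ) (((bM.tensorProduct bN).repr t) p) • (star (bM p.1) ⊗ₜ[ℂ] star (bN p.2))

/-- A weak Hopf `*`-algebra structure on a finite-dimensional `C*`-algebra `B`. -/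
structure WHA (B : Type) [NormedRing B] [StarRing B] [CStarRing B] [NormedAlgebra ℂ B]
    [StarModule ℂ B] [FiniteDimensional ℂ B] where
  Δ : B →ₗ[ℂ] B ⊗[ℂ] B
  ε : B →ₗ[ℂ] ℂ
  S : B →ₗ[ℂ] B
  coassoc : ∀ b : B, (TensorProduct.assoc ℂ B B B) ((TensorProduct.map Δ LinearMap.id) (Δ b)) =
    (TensorProduct.map LinearMap.id Δ) (Δ b)
  counit_left : ∀ b : B, (TensorProduct.lid ℂ B) ((TensorProduct.map ε LinearMap.id) (Δ b)) = b
  counit_right : ∀ b : B, (TensorProduct.rid ℂ B) ((TensorProduct.map LinearMap.id ε) (Δ b)) = b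
  comul_mul : ∀ a b : B, Δ (a * b) = Δ a * Δ b
  weak_counit : ∀ b c d : B, (TensorProduct.lid ℂ ℂ)
      ((TensorProduct.map (ε ∘ₗ LinearMap.mulLeft ℂ b) (ε ∘ₗ LinearMap.mulRight ℂ d)) (Δ c)) =
    ε (b * c * d)
  weak_comul_one : (TensorProduct.map Δ LinearMap.id) (Δ 1) =
    (Δ 1 ⊗ₜ[ℂ] (1 : B)) * ((TensorProduct.assoc ℂ B B B).symm ((1 : B) ⊗ₜ[ℂ] Δ 1))
  comul_star : ∀ b : B, Δ (star b) = tensorStar B B (Δ b)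
  antipode_mul : ∀ a b : B, S (a * b) = S b * S a
  antipode_one : S 1 = 1
  antipode_comul : ∀ b : B, Δ (S b) =
    (TensorProduct.map S S) ((TensorProduct.comm ℂ B B) (Δ b))
  counit_antipode : ∀ b : B, ε (S b) = ε b
  antipode_left : ∀ b : B, LinearMap.mul' ℂ B ((TensorProduct.map LinearMap.id S) (Δ b)) =
    (TensorProduct.lid ℂ B) ((TensorProduct.map ε LinearMap.id) (Δ 1 * (b ⊗ₜ[ℂ] (1 : B))))
  antipode_right : ∀ b : B, LinearMap.mul' ℂ B ((TensorProduct.map S LinearMap.id) (Δ b)) =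
    (TensorProduct.rid ℂ B) ((TensorProduct.map LinearMap.id ε) (((1 : B) ⊗ₜ[ℂ] b) * Δ 1))

namespace WHA

variable {B : Type} [NormedRing B] [StarRing B] [CStarRing B] [NormedAlgebra ℂ B]
  [StarModule ℂ B] [FiniteDimensional ℂ B]

/-- The target counital map `ε_t(b) = (ε ⊗ id)(Δ(1)(b ⊗ 1))`. -/
def εt (W : WHA B) (b : B) : B :=
  (TensorProduct.lid ℂ B) ((TensorProduct.map W.ε LinearMap.id) (W.Δ 1 * (b ⊗ₜ[ℂ] (1 : B))))

/-- The source counital map `ε_s(b) = (id ⊗ ε)((1 ⊗ b)Δ(1))`. -/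
def εs (W : WHA B) (b : B) : B :=
  (TensorProduct.rid ℂ B) ((TensorProduct.map LinearMap.id W.ε) (((1 : B) ⊗ₜ[ℂ] b) * W.Δ 1))

/-- The target counital subalgebra `B_t = ε_t(B)`. -/
def Bt (W : WHA B) : Submodule ℂ B := Submodule.span ℂ (Set.range W.εt)

/-- The source counital subalgebra `B_s = ε_s(B)`. -/
def Bs (W : WHA B) : Submodule ℂ B := Submodule.span ℂ (Set.range W.εs)

/-- The right adjoint action `b ◁ x = S(x₍₁₎) b x₍₂₎`. -/
def ad (W : WHA B) (b x : B) : B :=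
  LinearMap.mul' ℂ B ((TensorProduct.map W.S (LinearMap.mulLeft ℂ b)) (W.Δ x))

/-- `I` is a (right) coideal of `B`: a unital `*`-subalgebra with `Δ(I) ⊆ I ⊗ B`. -/
def IsCoideal (W : WHA B) (I : Submodule ℂ B) : Prop :=
  (1 : B) ∈ I ∧ (∀ a ∈ I, ∀ b ∈ I, a * b ∈ I) ∧ (∀ a ∈ I, star a ∈ I) ∧
    ∀ a ∈ I, W.Δ a ∈ Submodule.span ℂ {x : B ⊗[ℂ] B | ∃ u ∈ I, ∃ v : B, x = u ⊗ₜ[ℂ] v}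

/-- A coideal is invariant if `span{ b ◁ x : b ∈ I, x ∈ B } = I`. -/
def IsInvariant (W : WHA B) (I : Submodule ℂ B) : Prop :=
  Submodule.span ℂ {y : B | ∃ b ∈ I, ∃ x : B, y = W.ad b x} = I

end WHA

/-- A morphism of weak Hopf `*`-algebras. -/
structure WHAHom {B C : Type} [NormedRing B] [StarRing B] [CStarRing B] [NormedAlgebra ℂ B]
    [StarModule ℂ B] [FiniteDimensional ℂ B] [NormedRing C] [StarRing C] [CStarRing C]
    [NormedAlgebra ℂ C] [StarModule ℂ C] [FiniteDimensional ℂ C]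
    (W : WHA B) (W' : WHA C) where
  π : B →⋆ₐ[ℂ] C
  comul_comp : ∀ b : B, W'.Δ (π b) = (TensorProduct.map π.toLinearMap π.toLinearMap) (W.Δ b)
  antipode_comp : ∀ b : B, W'.S (π b) = π (W.S b)
  counit_comp : ∀ b : B, W'.ε (π b) = W.ε b


/-- The quotient type coideal `I(π) = {b : (π ⊗ id)Δ(b) = (π ⊗ id)((1 ⊗ b)Δ(1))}`. -/
def quotientCoideal {B C : Type} [NormedRing B] [StarRing B] [CStarRing B]
    [NormedAlgebra ℂ B] [StarModule ℂ B] [FiniteDimensional ℂ B]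
    [NormedRing C] [StarRing C] [CStarRing C] [NormedAlgebra ℂ C] [StarModule ℂ C]
    [FiniteDimensional ℂ C] (W : WHA B) (W' : WHA C) (h : WHAHom W W') : Set B :=
  {b : B | (TensorProduct.map h.π.toLinearMap LinearMap.id) (W.Δ b) =
    (TensorProduct.map h.π.toLinearMap LinearMap.id) (((1 : B) ⊗ₜ[ℂ] b) * W.Δ 1)}

/-- `tensorStar` is the canonical star operation of the tensor product. -/
theorem tensorStar_eq_star {M N : Type} [AddCommGroup M] [Module ℂ M] [Module.Finite ℂ M]
    [Module.Free ℂ M] [StarAddMonoid M] [StarModule ℂ M] [AddCommGroup N] [Module ℂ N]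
    [Module.Finite ℂ N] [Module.Free ℂ N] [StarAddMonoid N] [StarModule ℂ N] (t : M ⊗[ℂ] N) :
    tensorStar M N t = star t := by
  conv_rhs => rw [← ((Module.Free.chooseBasis ℂ M).tensorProduct
    (Module.Free.chooseBasis ℂ N)).sum_repr t]
  rw [star_sum]
  simp [tensorStar, Module.Basis.tensorProduct_apply']

theorem TensorProduct.star_assoc {B : Type} [NormedRing B] [StarRing B] [NormedAlgebra ℂ B]
    [StarModule ℂ B]
    (t : (B ⊗[ℂ] B) ⊗[ℂ] B) :
    star (Algebra.TensorProduct.assoc ℂ ℂ ℂ B B B t) =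
      Algebra.TensorProduct.assoc ℂ ℂ ℂ B B B (star t) := by
  induction t with
  | zero => simp
  | add x y hx hy => simp [hx, hy]
  | tmul x y =>
    induction x with
    | zero => simp
    | add x x' hx hx' => simp [add_tmul, hx, hx']
    | tmul x x' => simp

namespace WHA

variable {B : Type} [NormedRing B] [StarRing B] [CStarRing B] [NormedAlgebra ℂ B]
  [StarModule ℂ B] [FiniteDimensional ℂ B] (W : WHA B)

theorem comul_one_mul (x : B) : W.Δ 1 * W.Δ x = W.Δ x := by
  rw [← W.comul_mul, one_mul]

theorem map_id_comul_comul_one :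
    map LinearMap.id W.Δ (W.Δ 1) =
      Algebra.TensorProduct.assoc ℂ ℂ ℂ B B B (W.Δ 1 ⊗ₜ[ℂ] 1) * ((1 : B) ⊗ₜ[ℂ] W.Δ 1) := by
  have h := congrArg (Algebra.TensorProduct.assoc ℂ ℂ ℂ B B B) W.weak_comul_one
  rw [map_mul] at h
  rw [← W.coassoc]
  refine h.trans (congrArg _ ?_)
  exact (TensorProduct.assoc ℂ B B B).apply_symm_apply _

theorem star_comul (b : B) : star (W.Δ b) = W.Δ (star b) := by
  rw [W.comul_star, tensorStar_eq_star]

theorem star_map_id_comul (t : B ⊗[ℂ] B) :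
    star (map LinearMap.id W.Δ t) = map LinearMap.id W.Δ (star t) := by
  induction t with
  | zero => simp
  | tmul x y => simp [W.star_comul]
  | add x y hx hy => simp [hx, hy]

/-- The reversed order version of `WHA.weak_comul_one`, obtained by applying the star. -/
theorem map_id_comul_comul_one' :
    map LinearMap.id W.Δ (W.Δ 1) =
      ((1 : B) ⊗ₜ[ℂ] W.Δ 1) * Algebra.TensorProduct.assoc ℂ ℂ ℂ B B B (W.Δ 1 ⊗ₜ[ℂ] 1) := by
  have h := congrArg star W.map_id_comul_comul_one
  simpa [star_map_id_comul, star_comul, star_assoc] using h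

theorem map_id_comul_mul (t : B ⊗[ℂ] B) (y : B) :
    map LinearMap.id W.Δ ((1 ⊗ₜ[ℂ] y) * t) = (1 ⊗ₜ[ℂ] W.Δ y) * map LinearMap.id W.Δ t := by
  induction t with
  | zero => simp
  | tmul u v => simp [W.comul_mul]
  | add u v hu hv => simp [mul_add, hu, hv]

theorem map_lid_map_id_comul (t : B ⊗[ℂ] B) :
    map LinearMap.id ((TensorProduct.lid ℂ B).toLinearMap ∘ₗ map W.ε LinearMap.id)
      (map LinearMap.id W.Δ t) = t := by
  induction t with
  | zero => simp
  | tmul u v => simp [W.counit_left]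
  | add u v hu hv => rw [map_add, map_add, hu, hv]

/-- The source counital map as a linear map. -/
def εsₗ : B →ₗ[ℂ] B := LinearMap.mul' ℂ B ∘ₗ map W.S LinearMap.id ∘ₗ W.Δ

theorem εsₗ_apply (b : B) :
    W.εsₗ b = TensorProduct.rid ℂ B (map LinearMap.id W.ε ((1 ⊗ₜ[ℂ] b) * W.Δ 1)) :=
  W.antipode_right b

/-- `ε_s(y₍₁₎) ⊗ y₍₂₎ = 1₍₁₎ ⊗ y 1₍₂₎`. -/
theorem map_εsₗ_comul (y : B) :
    map W.εsₗ LinearMap.id (W.Δ y) = (1 ⊗ₜ[ℂ] y) * W.Δ 1 := by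
  rw [← W.map_lid_map_id_comul ((1 ⊗ₜ[ℂ] y) * W.Δ 1), map_id_comul_mul,
    map_id_comul_comul_one', ← mul_assoc, Algebra.TensorProduct.tmul_mul_tmul, one_mul,
    ← W.comul_mul, mul_one]
  generalize W.Δ y = t
  induction t with
  | zero => simp
  | add u v hu hv => simp only [map_add, tmul_add, add_mul, hu, hv]
  | tmul u v =>
    rw [map_tmul, εsₗ_apply]
    generalize W.Δ 1 = e
    induction e with
    | zero => simp
    | add e f he hf => simp only [map_add, add_tmul, mul_add, he, hf]
    | tmul e f => simp [smul_tmul]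

/-- `S(y₍₁₎) y₍₂₎ ⊗ y₍₃₎ = 1₍₁₎ ⊗ y 1₍₂₎`. -/
theorem antipode_mul_comul (y : B) :
    LinearMap.mul' ℂ (B ⊗[ℂ] B)
      (map ((TensorProduct.mk ℂ B B).flip 1 ∘ₗ W.S) W.Δ (W.Δ y)) = (1 ⊗ₜ[ℂ] y) * W.Δ 1 := by
  rw [← map_εsₗ_comul]
  have key : ∀ t : B ⊗[ℂ] (B ⊗[ℂ] B),
      LinearMap.mul' ℂ (B ⊗[ℂ] B) (map ((TensorProduct.mk ℂ B B).flip 1 ∘ₗ W.S) LinearMap.id t) =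
        map (LinearMap.mul' ℂ B ∘ₗ map W.S LinearMap.id) LinearMap.id
          ((TensorProduct.assoc ℂ B B B).symm t) := by
    intro t
    refine LinearMap.congr_fun (f := LinearMap.mul' ℂ (B ⊗[ℂ] B) ∘ₗ
        map ((TensorProduct.mk ℂ B B).flip 1 ∘ₗ W.S) LinearMap.id)
      (g := map (LinearMap.mul' ℂ B ∘ₗ map W.S LinearMap.id) LinearMap.id ∘ₗ
          (TensorProduct.assoc ℂ B B B).symm.toLinearMap) ?_ t
    ext x y z
    simp
  have h := key (map LinearMap.id W.Δ (W.Δ y))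
  rw [← W.coassoc, LinearEquiv.symm_apply_apply, W.coassoc] at h
  rwa [map_map, map_map] at h

/-- `Δ(z b) = (z ⊗ 1) Δ(b)` for `z = ε_t(y)`. -/
theorem comul_εt_mul (y b : B) :
    W.Δ (W.εt y * b) = (W.εt y ⊗ₜ[ℂ] 1) * W.Δ b := by
  have comul_slice (e : B ⊗[ℂ] B) :
      TensorProduct.lid ℂ (B ⊗[ℂ] B)
        (map (W.ε ∘ₗ LinearMap.mulRight ℂ y) LinearMap.id (map LinearMap.id W.Δ e)) =
      W.Δ (TensorProduct.lid ℂ B (map W.ε LinearMap.id (e * (y ⊗ₜ[ℂ] 1)))) := by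
    induction e with
    | zero => simp
    | add e f he hf => simp only [map_add, add_mul, he, hf]
    | tmul e f => simp
  have mul_slice (e f : B ⊗[ℂ] B) :
      TensorProduct.lid ℂ (B ⊗[ℂ] B) (map (W.ε ∘ₗ LinearMap.mulRight ℂ y) LinearMap.id
        (Algebra.TensorProduct.assoc ℂ ℂ ℂ B B B (e ⊗ₜ[ℂ] 1) * ((1 : B) ⊗ₜ[ℂ] f))) =
      (TensorProduct.lid ℂ B (map W.ε LinearMap.id (e * (y ⊗ₜ[ℂ] 1))) ⊗ₜ[ℂ] 1) * f := by
    induction e with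
    | zero => simp
    | add e e' he he' => simp only [map_add, add_mul, add_tmul, he, he']
    | tmul e e' =>
      induction f with
      | zero => simp
      | add f f' hf hf' => simp only [map_add, mul_add, tmul_add, hf, hf']
      | tmul f f' => simp [smul_tmul']
  have key : W.Δ (W.εt y) = (W.εt y ⊗ₜ[ℂ] 1) * W.Δ 1 := by
    rw [εt, ← comul_slice, map_id_comul_comul_one, mul_slice]
  rw [W.comul_mul, key, mul_assoc, comul_one_mul]

/-- The adjoint action as a linear map on `B ⊗ B`, so that `W.ad b x = W.adₗ b (W.Δ x)`. -/
def adₗ (b : B) : B ⊗[ℂ] B →ₗ[ℂ] B :=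
  LinearMap.mul' ℂ B ∘ₗ map W.S (LinearMap.mulLeft ℂ b)

/-- `Δ(S(x₍₁₎)) (1 ⊗ b) Δ(x₍₂₎) = (1 ⊗ S(x₍₁₎) b x₍₂₎) Δ(1)`. -/
theorem comul_antipode_mul_comul (b x : B) :
    LinearMap.mul' ℂ (B ⊗[ℂ] B) (map (W.Δ ∘ₗ W.S)
      (LinearMap.mulLeft ℂ ((1 : B) ⊗ₜ[ℂ] b) ∘ₗ W.Δ) (W.Δ x)) =
    (1 ⊗ₜ[ℂ] W.ad b x) * W.Δ 1 := by
  let K : (B ⊗[ℂ] B) ⊗[ℂ] B →ₗ[ℂ] B ⊗[ℂ] B := LinearMap.mul' ℂ (B ⊗[ℂ] B) ∘ₗ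
    map (map W.S W.S ∘ₗ (TensorProduct.comm ℂ B B).toLinearMap)
      (LinearMap.mulLeft ℂ ((1 : B) ⊗ₜ[ℂ] b) ∘ₗ W.Δ)
  have hK : LinearMap.mul' ℂ (B ⊗[ℂ] B) (map (W.Δ ∘ₗ W.S)
      (LinearMap.mulLeft ℂ ((1 : B) ⊗ₜ[ℂ] b) ∘ₗ W.Δ) (W.Δ x)) =
      K (map W.Δ LinearMap.id (W.Δ x)) := by
    generalize W.Δ x = t
    induction t with
    | zero => simp
    | add u v hu hv => simp only [map_add, hu, hv]
    | tmul u v => simp [K, W.antipode_comul]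
  rw [hK, ← (TensorProduct.assoc ℂ B B B).symm_apply_apply (map W.Δ LinearMap.id (W.Δ x)),
    W.coassoc]
  change _ = (1 ⊗ₜ[ℂ] W.adₗ b (W.Δ x)) * W.Δ 1
  generalize W.Δ x = t
  induction t with
  | zero => simp
  | add u v hu hv => simp only [map_add, tmul_add, add_mul, hu, hv]
  | tmul p y =>
    have hy : (1 ⊗ₜ[ℂ] W.adₗ b (p ⊗ₜ[ℂ] y)) * W.Δ 1 =
        ((1 : B) ⊗ₜ[ℂ] (W.S p * b)) * ((1 ⊗ₜ[ℂ] y) * W.Δ 1) := by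
      simp [adₗ, ← mul_assoc]
    rw [hy, ← antipode_mul_comul, map_tmul]
    generalize W.Δ y = t
    induction t with
    | zero => simp
    | add u v hu hv => simp only [map_add, tmul_add, mul_add, hu, hv]
    | tmul q v => simp [K, ← mul_assoc]

end WHA

/-- the quotient type coideal is invariant under the right adjoint action,
and its elements commute with `B_t`. -/
theorem quotientCoideal_invariant {B C : Type} [NormedRing B] [StarRing B] [CStarRing B]
    [NormedAlgebra ℂ B] [StarModule ℂ B] [FiniteDimensional ℂ B]
    [NormedRing C] [StarRing C] [CStarRing C] [NormedAlgebra ℂ C] [StarModule ℂ C]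
    [FiniteDimensional ℂ C] (W : WHA B) (W' : WHA C) (h : WHAHom W W')
    (hsurj : Function.Surjective h.π) :
    (∀ b ∈ quotientCoideal W W' h, ∀ x : B, W.ad b x ∈ quotientCoideal W W' h) ∧
    (∀ b ∈ quotientCoideal W W' h, ∀ z ∈ W.Bt, b * z = z * b) := by
  let P : B ⊗[ℂ] B →ₐ[ℂ] C ⊗[ℂ] B :=
    Algebra.TensorProduct.map h.π.toAlgHom (AlgHom.id ℂ B)
  have mem_iff : ∀ b, b ∈ quotientCoideal W W' h ↔ P (W.Δ b) = P ((1 ⊗ₜ[ℂ] b) * W.Δ 1) :=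
    fun _ => Iff.rfl
  refine ⟨fun b hb x => ?_, fun b hb z hz => ?_⟩
  · rw [mem_iff] at hb ⊢
    rw [← W.comul_antipode_mul_comul]
    change P (W.Δ (W.adₗ b (W.Δ x))) = _
    generalize W.Δ x = t
    induction t with
    | zero => simp
    | add u v hu hv => simp only [map_add, hu, hv]
    | tmul u v =>
      have huv : W.adₗ b (u ⊗ₜ[ℂ] v) = W.S u * (b * v) := by simp [WHA.adₗ]
      have hbv : P (W.Δ (b * v)) = P ((1 ⊗ₜ[ℂ] b) * W.Δ v) := by
        rw [W.comul_mul, map_mul, hb, ← map_mul, mul_assoc, W.comul_one_mul]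
      rw [huv, W.comul_mul, map_mul, hbv, ← map_mul]
      simp
  · rw [mem_iff] at hb
    induction hz using Submodule.span_induction with
    | zero => simp
    | add u v _ _ hu hv => rw [mul_add, add_mul, hu, hv]
    | smul c u _ hu => rw [mul_smul_comm, smul_mul_assoc, hu]
    | mem z hz =>
      obtain ⟨y, rfl⟩ := hz
      let E : C ⊗[ℂ] B →ₗ[ℂ] B := (TensorProduct.lid ℂ B).toLinearMap ∘ₗ map W'.ε LinearMap.id
      have hE : ∀ t, E (P t) = TensorProduct.lid ℂ B (map W.ε LinearMap.id t) := by
        intro t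
        induction t with
        | zero => simp
        | add u v hu hv => simp only [map_add, hu, hv]
        | tmul u v => simp [E, P, h.counit_comp]
      have h1 : P (W.Δ (W.εt y * b)) = P ((1 ⊗ₜ[ℂ] b) * W.Δ (W.εt y)) := by
        have hz1 : W.Δ (W.εt y) = (W.εt y ⊗ₜ[ℂ] 1) * W.Δ 1 := by
          simpa using W.comul_εt_mul y 1
        rw [W.comul_εt_mul, map_mul, hb, ← map_mul, hz1, ← mul_assoc, ← mul_assoc]
        simp
      have h2 := congrArg E h1
      rw [hE, hE, W.counit_left] at h2
      rw [h2]
      have h3 : ∀ t : B ⊗[ℂ] B, TensorProduct.lid ℂ B (map W.ε LinearMap.id ((1 ⊗ₜ[ℂ] b) * t)) =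
          b * TensorProduct.lid ℂ B (map W.ε LinearMap.id t) := by
        intro t
        induction t with
        | zero => simp
        | add u v hu hv => simp only [map_add, mul_add, hu, hv]
        | tmul u v => simp
      rw [h3, W.counit_left]

end
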